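/- Let G be a countable group with sofic approximation Σ, (𝒳,d) a compact metric space, and μ an ERGODIC shift-invariant probability measure on 𝒳^G. If μ_n ∈ Pr(𝒳^{V_n}) locally weak* converges to μ (for every weak* neighbourhood O of μ, the proportion of v ∈ V_n with (Π^{σ_n}_v)_*μ_n ∈ O tends to 1), then μ_n quenched converges to μ: additionally μ_n(Ω(O,σ_n)) → 1 for every weak* neighbourhood O of μ, where Ω(O,σ_n) := {x ∈ 𝒳^{V_n} : P^{σ_n}_x ∈ O}. -/

import Mathlib

open MeasureTheory Filter Topology
open scoped ENNReal NNReal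

/-- The right-shift action: `(S^g y) h = y (h * g)`. -/
def shiftMap (G : Type*) [Group G] (𝒳 : Type*) (g : G) : (G → 𝒳) → (G → 𝒳) :=
  fun y h => y (h * g)

/-- The pullback name of `x : 𝒳^V` at `v` over `σ`. -/
def pullbackName {G W 𝒳 : Type*} (σ : G → Equiv.Perm W) (v : W) (x : W → 𝒳) : G → 𝒳 :=
  fun g => x (σ g v)

lemma measurable_pullbackName {G W 𝒳 : Type*} [MeasurableSpace 𝒳]
    (σ : G → Equiv.Perm W) (v : W) : Measurable (pullbackName (𝒳 := 𝒳) σ v) :=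
  measurable_pi_lambda _ fun _ => measurable_pi_apply _

/-- The pushforward `(Π^σ_v)_* θ` of a probability measure on `𝒳^W` to `𝒳^G`. -/
noncomputable def pushName {G W 𝒳 : Type*} [MeasurableSpace 𝒳]
    (σ : G → Equiv.Perm W) (v : W) (θ : ProbabilityMeasure (W → 𝒳)) :
    ProbabilityMeasure (G → 𝒳) :=
  θ.map (measurable_pullbackName σ v).aemeasurable

/-- The empirical distribution `P^σ_x` as a probability measure on `𝒳^G`. -/
noncomputable def empProb {G W 𝒳 : Type*} [Fintype W] [Nonempty W] [MeasurableSpace 𝒳]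
    (σ : G → Equiv.Perm W) (x : W → 𝒳) : ProbabilityMeasure (G → 𝒳) :=
  ⟨(Fintype.card W : ℝ≥0∞)⁻¹ • ∑ v : W, Measure.dirac (pullbackName σ v x), by
    constructor
    simp only [Measure.smul_apply, Measure.finset_sum_apply, measure_univ,
      Finset.sum_const, Finset.card_univ, nsmul_eq_mul, mul_one, smul_eq_mul]
    exact ENNReal.inv_mul_cancel (by simp [Fintype.card_ne_zero]) (by simp)⟩


/-- A function invariant under an ergodic countable group action is a.e. constant. -/
lemma ergAux_const {G α : Type*} [Group G] [Countable G] [MeasurableSpace α]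
    (μ : Measure α) [IsProbabilityMeasure μ] (T : G → α → α)
    (hTm : ∀ g, MeasurePreserving (T g) μ μ)
    (hT1 : ∀ y, T 1 y = y) (hTT : ∀ g h y, T g (T h y) = T (g * h) y)
    (herg : ∀ A : Set α, MeasurableSet A → (∀ g : G, T g ⁻¹' A = A) → μ A = 0 ∨ μ A = 1)
    (v : α → ℝ) (hv : Measurable v) (hinv : ∀ g, v ∘ T g =ᵐ[μ] v) :
    ∃ c, v =ᵐ[μ] Function.const α c := by
  refine exists_eventuallyEq_const_of_forall_separating MeasurableSet fun U hU ↦ ?_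
  set A' : Set α := ⋂ g, T g ⁻¹' (v ⁻¹' U) with hA'
  have hm : MeasurableSet A' := MeasurableSet.iInter fun g => (hTm g).measurable (hv hU)
  have hi : ∀ h, T h ⁻¹' A' = A' := by
    intro h
    ext y
    simp only [hA', Set.mem_preimage, Set.mem_iInter, hTT]
    constructor
    · intro H g
      simpa using H (g * h⁻¹)
    · intro H g
      exact H _
  have hall : ∀ᵐ y ∂μ, ∀ g, v (T g y) = v y := by
    rw [ae_all_iff]
    intro g
    exact hinv g
  rcases herg A' hm hi with h0 | h1
  · right
    have : ∀ᵐ y ∂μ, y ∉ A' := measure_eq_zero_iff_ae_notMem.1 h0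
    filter_upwards [this, hall] with y hy hy2 hyU
    apply hy
    simp only [hA', Set.mem_preimage, Set.mem_iInter, hy2]
    exact fun _ => hyU
  · left
    have : ∀ᵐ y ∂μ, y ∈ A' := (mem_ae_iff_prob_eq_one hm).2 h1
    filter_upwards [this] with y hy
    have := Set.mem_iInter.1 hy 1
    simpa [hT1] using this

lemma ergAux_L1_le {α : Type*} [MeasurableSpace α]
    (μ : Measure α) [IsProbabilityMeasure μ] (w : Lp ℝ 2 μ) :
    ∫ y, |w y| ∂μ ≤ ‖w‖ := by
  have h1 : MemLp w 1 μ := (Lp.memLp w).mono_exponent (by norm_num)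
  have h2 : eLpNorm w 1 μ ≤ eLpNorm w 2 μ :=
    eLpNorm_le_eLpNorm_of_exponent_le (by norm_num) (Lp.aestronglyMeasurable w)
  have h3 : ∫ y, |w y| ∂μ = (eLpNorm w 1 μ).toReal := by
    have := integral_norm_eq_lintegral_enorm (Lp.aestronglyMeasurable w)
    rw [eLpNorm_one_eq_lintegral_enorm, ← this]
    rfl
  rw [h3, Lp.norm_def]
  exact ENNReal.toReal_mono (Lp.eLpNorm_ne_top w) h2

/-- Mean ergodic theorem (Alaoglu–Birkhoff) for an ergodic action of a countable group. -/
lemma ergAux_mean {G α : Type*} [Group G] [Countable G] [MeasurableSpace α]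
    (μ : Measure α) [IsProbabilityMeasure μ] (T : G → α → α)
    (hTm : ∀ g, MeasurePreserving (T g) μ μ)
    (hT1 : ∀ y, T 1 y = y) (hTT : ∀ g h y, T g (T h y) = T (g * h) y)
    (herg : ∀ A : Set α, MeasurableSet A → (∀ g : G, T g ⁻¹' A = A) → μ A = 0 ∨ μ A = 1)
    (f : α → ℝ) (hf : MemLp f 2 μ) (ε : ℝ) (hε : 0 < ε) :
    ∃ F ∈ convexHull ℝ (Set.range fun g => f ∘ T g), ∫ y, |F y - ∫ z, f z ∂μ| ∂μ < ε := by
  have hfg : ∀ g, MemLp (f ∘ T g) 2 μ := fun g => hf.comp_measurePreserving (hTm g)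
  let o : G → Lp ℝ 2 μ := fun g => (hfg g).toLp _
  let C : Set (Lp ℝ 2 μ) := convexHull ℝ (Set.range o)
  let K : Set (Lp ℝ 2 μ) := closure C
  let U : G → (Lp ℝ 2 μ →ₗᵢ[ℝ] Lp ℝ 2 μ) := fun g => Lp.compMeasurePreservingₗᵢ ℝ (T g) (hTm g)
  have hUo : ∀ g h, U h (o g) = o (g * h) := by
    intro g h
    have : U h (o g) = ((hfg g).comp_measurePreserving (hTm h)).toLp _ := rfl
    rw [this]
    apply (MemLp.toLp_eq_toLp_iff _ _).2
    refine Eventually.of_forall fun y => ?_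
    simp [hTT]
  have hCconv : Convex ℝ C := convex_convexHull ℝ _
  have hUC : ∀ h, Set.MapsTo (U h) C C := by
    intro h
    have : C ⊆ (U h).toLinearMap ⁻¹' C := by
      apply convexHull_min
      · rintro _ ⟨g, rfl⟩
        change U h (o g) ∈ C
        rw [hUo]
        exact subset_convexHull ℝ _ ⟨_, rfl⟩
      · exact hCconv.linear_preimage _
    exact this
  have hUK : ∀ h, Set.MapsTo (U h) K K := fun h => (hUC h).closure (U h).continuous
  have hKconv : Convex ℝ K := hCconv.closure
  have hKne : K.Nonempty := ⟨o 1, subset_closure (subset_convexHull ℝ _ ⟨1, rfl⟩)⟩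
  obtain ⟨v, hvK, hvmin⟩ := exists_norm_eq_iInf_of_complete_convex hKne
    (isClosed_closure.isComplete) hKconv 0
  have hvin := (norm_eq_iInf_iff_real_inner_le_zero hKconv hvK).1 hvmin
  have hUv : ∀ h, U h v = v := by
    intro h
    have h1 := hvin _ (hUK h hvK)
    have h2 : ‖U h v‖ = ‖v‖ := (U h).norm_map v
    rw [zero_sub, inner_neg_left, inner_sub_right, real_inner_self_eq_norm_sq] at h1
    have h3 := norm_sub_sq_real v (U h v)
    rw [h2] at h3
    have h4 : ‖v - U h v‖ = 0 := by
      have := norm_nonneg (v - U h v)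
      nlinarith
    exact (sub_eq_zero.1 (norm_eq_zero.1 h4)).symm
  have hvinv : ∀ g, v ∘ T g =ᵐ[μ] v := by
    intro g
    have h1 := Lp.coeFn_compMeasurePreserving v (hTm g)
    have h2 : Lp.compMeasurePreserving (T g) (hTm g) v = v := hUv g
    rw [h2] at h1
    exact h1.symm
  obtain ⟨c, hc⟩ := ergAux_const μ T hTm hT1 hTT herg v (Lp.stronglyMeasurable v).measurable hvinv
  obtain ⟨w, hwC, hw⟩ := Metric.mem_closure_iff.1 hvK (ε / 2) (by linarith)
  have hrep : C ⊆ {w | ∃ F ∈ convexHull ℝ (Set.range fun g => f ∘ T g), w =ᵐ[μ] F} := by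
    apply convexHull_min
    · rintro _ ⟨g, rfl⟩
      exact ⟨_, subset_convexHull ℝ _ ⟨g, rfl⟩, (hfg g).coeFn_toLp⟩
    · rintro w1 ⟨F1, hF1, h1⟩ w2 ⟨F2, hF2, h2⟩ a b ha hb hab
      refine ⟨a • F1 + b • F2, convex_convexHull ℝ _ hF1 hF2 ha hb hab, ?_⟩
      filter_upwards [h1, h2, Lp.coeFn_add (a • w1) (b • w2), Lp.coeFn_smul a w1,
        Lp.coeFn_smul b w2] with y e1 e2 e3 e4 e5
      rw [e3, Pi.add_apply, e4, e5]
      simp only [Pi.add_apply, Pi.smul_apply, e1, e2]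
  obtain ⟨F, hF, hwF⟩ := hrep hwC
  have hint : convexHull ℝ (Set.range fun g => f ∘ T g) ⊆
      {F | Integrable F μ ∧ ∫ y, F y ∂μ = ∫ y, f y ∂μ} := by
    apply convexHull_min
    · rintro _ ⟨g, rfl⟩
      refine ⟨(hfg g).integrable (by norm_num), ?_⟩
      have h1 : AEStronglyMeasurable f (Measure.map (T g) μ) := by
        rw [(hTm g).map_eq]
        exact hf.1
      have := integral_map (hTm g).measurable.aemeasurable h1
      rw [(hTm g).map_eq] at this
      exact this.symm
    · rintro F1 ⟨i1, h1⟩ F2 ⟨i2, h2⟩ a b ha hb hab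
      refine ⟨(i1.smul a).add (i2.smul b), ?_⟩
      have : ∫ y, (a • F1 + b • F2) y ∂μ = a * ∫ y, F1 y ∂μ + b * ∫ y, F2 y ∂μ := by
        simp only [Pi.add_apply, Pi.smul_apply, smul_eq_mul]
        rw [integral_add (i1.const_mul a) (i2.const_mul b), integral_const_mul,
          integral_const_mul]
      rw [this, h1, h2, ← add_mul, hab, one_mul]
  obtain ⟨hFi, hFe⟩ := hint hF
  have hd : ∫ y, |F y - c| ∂μ < ε / 2 := by
    have h1 := ergAux_L1_le μ (w - v)
    have h2 : ∫ y, |F y - c| ∂μ = ∫ y, |(w - v : Lp ℝ 2 μ) y| ∂μ := by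
      apply integral_congr_ae
      filter_upwards [hwF, hc, Lp.coeFn_sub w v] with y e1 e2 e3
      rw [e3, Pi.sub_apply, e1, e2]
      rfl
    rw [h2]
    rw [dist_comm, dist_eq_norm] at hw
    linarith
  have hd2 : |(∫ y, f y ∂μ) - c| < ε / 2 := by
    refine lt_of_le_of_lt ?_ hd
    have : (∫ y, f y ∂μ) - c = ∫ y, (F y - c) ∂μ := by
      rw [integral_sub hFi (integrable_const c), hFe]
      simp
    rw [this]
    exact abs_integral_le_integral_abs
  refine ⟨F, hF, ?_⟩
  calc ∫ y, |F y - ∫ z, f z ∂μ| ∂μ ≤ ∫ y, (|F y - c| + |(∫ z, f z ∂μ) - c|) ∂μ := by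
        apply integral_mono
        · exact (hFi.sub (integrable_const _)).abs
        · exact ((hFi.sub (integrable_const _)).abs).add (integrable_const _)
        · intro y
          simp only
          rw [abs_sub_comm (∫ z, f z ∂μ) c]
          exact abs_sub_le _ _ _
    _ = (∫ y, |F y - c| ∂μ) + |(∫ z, f z ∂μ) - c| := by
        have hi : Integrable (fun y => |F y - c|) μ := (hFi.sub (integrable_const _)).abs
        rw [integral_add hi (integrable_const _)]
        simp
    _ < ε := by linarith

lemma finDep_aux {G 𝒳 : Type*} [MetricSpace 𝒳] [CompactSpace 𝒳]
    (f : (G → 𝒳) → ℝ) (hf : Continuous f) (δ : ℝ) (hδ : 0 < δ) :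
    ∃ H : Finset G, ∀ y z : G → 𝒳, (∀ h ∈ H, y h = z h) → |f y - f z| < δ := by
  have huc := CompactSpace.uniformContinuous_of_continuous hf
  have h1 : {p : (G → 𝒳) × (G → 𝒳) | dist (f p.1) (f p.2) < δ} ∈ uniformity (G → 𝒳) :=
    huc (Metric.dist_mem_uniformity hδ)
  rw [Pi.uniformity, Filter.mem_iInf] at h1
  obtain ⟨I, hI, V, hV, hVe⟩ := h1
  refine ⟨hI.toFinset, fun y z hyz => ?_⟩
  have : (y, z) ∈ {p : (G → 𝒳) × (G → 𝒳) | dist (f p.1) (f p.2) < δ} := by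
    rw [hVe, Set.mem_iInter]
    intro i
    obtain ⟨t, ht, htV⟩ := Filter.mem_comap.1 (hV i)
    apply htV
    have : y i = z i := hyz i (by simp)
    simp only [Set.mem_preimage, this]
    exact refl_mem_uniformity ht
  exact this

/-- The density of the complement of a set of density tending to one tends to zero. -/
lemma compl_density_aux (V : ℕ → Type*) [∀ n, Fintype (V n)] [∀ n, Nonempty (V n)]
    (p : ∀ n, V n → Prop)
    (h : Tendsto (fun n => (Nat.card {v : V n // p n v} : ℝ) / (Nat.card (V n))) atTop (𝓝 1)) :
    Tendsto (fun n => (Fintype.card (V n) : ℝ)⁻¹ * ∑ v : V n, ({v | ¬ p n v} : Set (V n)).indicator 1 v)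
      atTop (𝓝 0) := by
  classical
  have h2 : Tendsto (fun n => 1 - (Nat.card {v : V n // p n v} : ℝ) / (Nat.card (V n))) atTop
      (𝓝 (1 - 1)) := tendsto_const_nhds.sub h
  rw [sub_self] at h2
  refine h2.congr fun n => ?_
  have hc : (Fintype.card (V n) : ℝ) ≠ 0 := by simp
  have h3 : (∑ v : V n, ({v | ¬ p n v} : Set (V n)).indicator (1 : V n → ℝ) v)
      = (Fintype.card (V n) : ℝ) - Nat.card {v : V n // p n v} := by
    rw [Nat.card_eq_fintype_card, Fintype.card_subtype]
    have : ∀ v : V n, ({v | ¬ p n v} : Set (V n)).indicator (1 : V n → ℝ) v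
        = 1 - if p n v then 1 else 0 := by
      intro v
      by_cases hv : p n v <;> simp [hv]
    simp_rw [this]
    rw [Finset.sum_sub_distrib]
    simp
  rw [h3, Nat.card_eq_fintype_card (α := V n)]
  field_simp

lemma shiftMap_continuous_aux {G 𝒳 : Type*} [Group G] [TopologicalSpace 𝒳] (g : G) :
    Continuous (shiftMap G 𝒳 g) := by
  unfold shiftMap
  fun_prop

lemma sofic_avg_aux {G 𝒳 : Type*} [Group G] [MetricSpace 𝒳] [CompactSpace 𝒳]
    (V : ℕ → Type*) [∀ n, Fintype (V n)] [∀ n, Nonempty (V n)]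
    (σ : ∀ n, G → Equiv.Perm (V n))
    (hσ1 : ∀ g h : G,
      Tendsto (fun n => (Nat.card {v : V n // σ n g (σ n h v) = σ n (g * h) v} : ℝ)
          / (Nat.card (V n))) atTop (𝓝 1))
    (f : (G → 𝒳) → ℝ) (hf : Continuous f) (M : ℝ) (hM : ∀ y, |f y| ≤ M) (g : G)
    (δ : ℝ) (hδ : 0 < δ) :
    ∀ᶠ n in atTop, ∀ x : V n → 𝒳,
      |(Fintype.card (V n) : ℝ)⁻¹ * ∑ v, f (shiftMap G 𝒳 g (pullbackName (σ n) v x))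
        - (Fintype.card (V n) : ℝ)⁻¹ * ∑ v, f (pullbackName (σ n) v x)| ≤ δ := by
  obtain ⟨H, hH⟩ := finDep_aux f hf (δ / 2) (by linarith)
  have hlim : Tendsto (fun n => 2 * M * ∑ h ∈ H, (Fintype.card (V n) : ℝ)⁻¹ *
      ∑ v : V n, ({v | ¬ σ n h (σ n g v) = σ n (h * g) v} : Set (V n)).indicator 1 v)
      atTop (𝓝 (2 * M * ∑ h ∈ H, 0)) :=
    (tendsto_finsetSum _ fun h _ => compl_density_aux V _ (hσ1 h g)).const_mul _
  rw [Finset.sum_const_zero, mul_zero] at hlim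
  filter_upwards [hlim.eventually (gt_mem_nhds (show (0 : ℝ) < δ / 2 by linarith))] with n hn x
  have hc : (0 : ℝ) < Fintype.card (V n) := by exact_mod_cast Fintype.card_pos
  have hre : ∑ v, f (pullbackName (σ n) v x) = ∑ v, f (pullbackName (σ n) (σ n g v) x) :=
    (Equiv.sum_comp (σ n g) (fun v => f (pullbackName (σ n) v x))).symm
  rw [hre, ← mul_sub, ← Finset.sum_sub_distrib, abs_mul, abs_of_pos (inv_pos.2 hc)]
  have hterm : ∀ v : V n, |f (shiftMap G 𝒳 g (pullbackName (σ n) v x))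
      - f (pullbackName (σ n) (σ n g v) x)| ≤ δ / 2 + 2 * M * ∑ h ∈ H,
        ({v | ¬ σ n h (σ n g v) = σ n (h * g) v} : Set (V n)).indicator 1 v := by
    intro v
    have hM0 : 0 ≤ M := (abs_nonneg _).trans (hM (pullbackName (σ n) v x))
    have hnn : ∀ h ∈ H, (0 : ℝ) ≤
        ({v | ¬ σ n h (σ n g v) = σ n (h * g) v} : Set (V n)).indicator 1 v :=
      fun h _ => Set.indicator_nonneg (fun _ _ => zero_le_one) _
    by_cases hgood : ∀ h ∈ H, σ n h (σ n g v) = σ n (h * g) v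
    · have h1 := hH (shiftMap G 𝒳 g (pullbackName (σ n) v x)) (pullbackName (σ n) (σ n g v) x)
        (fun h hh => by simp only [shiftMap, pullbackName, hgood h hh])
      have h2 := mul_nonneg (mul_nonneg zero_le_two hM0) (Finset.sum_nonneg hnn)
      linarith
    · push Not at hgood
      obtain ⟨h, hh, hne⟩ := hgood
      have h1 : (1 : ℝ) ≤ ∑ h ∈ H,
          ({v | ¬ σ n h (σ n g v) = σ n (h * g) v} : Set (V n)).indicator 1 v := by
        refine le_trans ?_ (Finset.single_le_sum hnn hh)
        rw [Set.indicator_of_mem (by exact hne)]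
        simp
      have h2 := abs_sub (f (shiftMap G 𝒳 g (pullbackName (σ n) v x)))
        (f (pullbackName (σ n) (σ n g v) x))
      have h3 := hM (shiftMap G 𝒳 g (pullbackName (σ n) v x))
      have h4 := hM (pullbackName (σ n) (σ n g v) x)
      nlinarith
  have hsum : |∑ v, (f (shiftMap G 𝒳 g (pullbackName (σ n) v x))
      - f (pullbackName (σ n) (σ n g v) x))| ≤ ∑ v : V n, (δ / 2 + 2 * M * ∑ h ∈ H,
        ({v | ¬ σ n h (σ n g v) = σ n (h * g) v} : Set (V n)).indicator 1 v) :=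
    (Finset.abs_sum_le_sum_abs _ _).trans (Finset.sum_le_sum fun v _ => hterm v)
  refine (mul_le_mul_of_nonneg_left hsum (inv_pos.2 hc).le).trans ?_
  rw [Finset.sum_add_distrib, ← Finset.mul_sum, Finset.sum_comm, mul_add]
  rw [← Finset.mul_sum] at hn
  simp only [Finset.sum_const, Finset.card_univ, nsmul_eq_mul]
  rw [inv_mul_cancel_left₀ hc.ne', mul_left_comm]
  linarith

lemma sofic_hull_aux {G 𝒳 : Type*} [Group G] [MetricSpace 𝒳] [CompactSpace 𝒳]
    (V : ℕ → Type*) [∀ n, Fintype (V n)] [∀ n, Nonempty (V n)]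
    (σ : ∀ n, G → Equiv.Perm (V n))
    (hσ1 : ∀ g h : G,
      Tendsto (fun n => (Nat.card {v : V n // σ n g (σ n h v) = σ n (g * h) v} : ℝ)
          / (Nat.card (V n))) atTop (𝓝 1))
    (f : (G → 𝒳) → ℝ) (hf : Continuous f) (M : ℝ) (hM : ∀ y, |f y| ≤ M)
    (F : (G → 𝒳) → ℝ) (hF : F ∈ convexHull ℝ (Set.range fun g => f ∘ shiftMap G 𝒳 g)) :
    Continuous F ∧ (∀ y, |F y| ≤ M) ∧ ∀ δ : ℝ, 0 < δ → ∀ᶠ n in atTop, ∀ x : V n → 𝒳,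
      |(Fintype.card (V n) : ℝ)⁻¹ * ∑ v, F (pullbackName (σ n) v x)
        - (Fintype.card (V n) : ℝ)⁻¹ * ∑ v, f (pullbackName (σ n) v x)| ≤ δ := by
  revert F
  apply convexHull_min
  · rintro _ ⟨g, rfl⟩
    exact ⟨hf.comp (shiftMap_continuous_aux g), fun y => hM _,
      fun δ hδ => sofic_avg_aux V σ hσ1 f hf M hM g δ hδ⟩
  · rintro F1 ⟨c1, b1, h1⟩ F2 ⟨c2, b2, h2⟩ a b ha hb hab
    refine ⟨(c1.const_smul a).add (c2.const_smul b), fun y => ?_, fun δ hδ => ?_⟩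
    · have h3 := abs_add_le (a * F1 y) (b * F2 y)
      rw [abs_mul, abs_mul, abs_of_nonneg ha, abs_of_nonneg hb] at h3
      have h4 := mul_le_mul_of_nonneg_left (b1 y) ha
      have h5 := mul_le_mul_of_nonneg_left (b2 y) hb
      have h6 : a * M + b * M = M := by rw [← add_mul, hab, one_mul]
      simp only [Pi.add_apply, Pi.smul_apply, smul_eq_mul]
      linarith
    · filter_upwards [h1 δ hδ, h2 δ hδ] with n e1 e2 x
      specialize e1 x
      specialize e2 x
      simp only [Pi.add_apply, Pi.smul_apply, smul_eq_mul, Finset.sum_add_distrib,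
        ← Finset.mul_sum]
      set s := (Fintype.card (V n) : ℝ)⁻¹
      set A := s * ∑ v, F1 (pullbackName (σ n) v x) with hA
      set B := s * ∑ v, F2 (pullbackName (σ n) v x) with hB
      set C := s * ∑ v, f (pullbackName (σ n) v x)
      have : s * (a * ∑ v, F1 (pullbackName (σ n) v x) + b * ∑ v, F2 (pullbackName (σ n) v x)) - C
          = a * (A - C) + b * (B - C) := by
        rw [hA, hB]
        linear_combination C * hab
      rw [this]
      have h3 := abs_add_le (a * (A - C)) (b * (B - C))
      rw [abs_mul, abs_mul, abs_of_nonneg ha, abs_of_nonneg hb] at h3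
      have h4 := mul_le_mul_of_nonneg_left e1 ha
      have h5 := mul_le_mul_of_nonneg_left e2 hb
      have h6 : a * δ + b * δ = δ := by rw [← add_mul, hab, one_mul]
      linarith

lemma local_avg_aux {G 𝒳 : Type*} [Countable G]
    [MetricSpace 𝒳] [CompactSpace 𝒳] [SecondCountableTopology 𝒳]
    [MeasurableSpace 𝒳] [BorelSpace 𝒳]
    (V : ℕ → Type*) [∀ n, Fintype (V n)] [∀ n, Nonempty (V n)]
    (σ : ∀ n, G → Equiv.Perm (V n))
    (μ : ProbabilityMeasure (G → 𝒳))
    (μn : ∀ n, ProbabilityMeasure (V n → 𝒳))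
    (hlw : ∀ O ∈ 𝓝 μ,
      Tendsto (fun n => (Nat.card {v : V n // pushName (σ n) v (μn n) ∈ O} : ℝ)
          / (Nat.card (V n))) atTop (𝓝 1))
    (h : (G → 𝒳) → ℝ) (hc : Continuous h) (M : ℝ) (h0 : ∀ y, 0 ≤ h y) (hM : ∀ y, h y ≤ M)
    (ε : ℝ) (hε : ∫ y, h y ∂(μ : Measure (G → 𝒳)) < ε) :
    ∀ᶠ n in atTop, (Fintype.card (V n) : ℝ)⁻¹ *
      ∑ v, ∫ x, h (pullbackName (σ n) v x) ∂(μn n : Measure (V n → 𝒳)) < ε := by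
  obtain ⟨e, he1, he2⟩ := exists_between hε
  have he0 : 0 < e := lt_of_le_of_lt (integral_nonneg h0) he1
  let O : Set (ProbabilityMeasure (G → 𝒳)) := {ν | ∫ y, h y ∂(ν : Measure (G → 𝒳)) < e}
  have hO : O ∈ 𝓝 μ := by
    have hcont := ProbabilityMeasure.continuous_integral_continuousMap (X := G → 𝒳)
      (⟨h, hc⟩ : C(G → 𝒳, ℝ))
    exact hcont.continuousAt.eventually (gt_mem_nhds he1)
  have hlim := (compl_density_aux V _ (hlw O hO)).const_mul M
  rw [mul_zero] at hlim
  filter_upwards [hlim.eventually (gt_mem_nhds (show (0 : ℝ) < ε - e by linarith))] with n hn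
  have hcd : (0 : ℝ) < Fintype.card (V n) := by exact_mod_cast Fintype.card_pos
  have hterm : ∀ v : V n, ∫ x, h (pullbackName (σ n) v x) ∂(μn n : Measure (V n → 𝒳)) ≤
      e + M * ({v | ¬ pushName (σ n) v (μn n) ∈ O} : Set (V n)).indicator 1 v := by
    intro v
    by_cases hv : pushName (σ n) v (μn n) ∈ O
    · rw [Set.indicator_of_notMem (by simpa using hv)]
      have h1 : ∫ y, h y ∂(pushName (σ n) v (μn n) : Measure (G → 𝒳)) < e := hv
      have h2 : (pushName (σ n) v (μn n) : Measure (G → 𝒳)) =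
        Measure.map (pullbackName (σ n) v) (μn n : Measure (V n → 𝒳)) := rfl
      rw [h2, integral_map (measurable_pullbackName _ _).aemeasurable
        hc.aestronglyMeasurable] at h1
      linarith
    · rw [Set.indicator_of_mem (by exact hv)]
      have h1 : ∫ x, h (pullbackName (σ n) v x) ∂(μn n : Measure (V n → 𝒳)) ≤
          ∫ x, M ∂(μn n : Measure (V n → 𝒳)) := by
        apply integral_mono_of_nonneg
        · exact Eventually.of_forall fun x => h0 _
        · exact integrable_const _
        · exact Eventually.of_forall fun x => hM _
      simp at h1
      simp
      linarith
  have hsum := Finset.sum_le_sum fun (v : V n) (_ : v ∈ Finset.univ) => hterm v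
  refine (mul_le_mul_of_nonneg_left hsum (inv_pos.2 hcd).le).trans_lt ?_
  rw [Finset.sum_add_distrib, ← Finset.mul_sum, mul_add]
  simp only [Finset.sum_const, Finset.card_univ, nsmul_eq_mul]
  rw [inv_mul_cancel_left₀ hcd.ne', mul_left_comm]
  linarith

lemma integral_empProb_aux {G W 𝒳 : Type*} [Countable G] [Fintype W] [Nonempty W]
    [MetricSpace 𝒳] [SecondCountableTopology 𝒳] [MeasurableSpace 𝒳] [BorelSpace 𝒳]
    (σ : G → Equiv.Perm W) (x : W → 𝒳) (f : (G → 𝒳) → ℝ) (hf : Continuous f) :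
    ∫ y, f y ∂(empProb σ x : Measure (G → 𝒳)) =
      (Fintype.card W : ℝ)⁻¹ * ∑ v, f (pullbackName σ v x) := by
  have h : (empProb σ x : Measure (G → 𝒳)) =
    (Fintype.card W : ℝ≥0∞)⁻¹ • ∑ v : W, Measure.dirac (pullbackName σ v x) := rfl
  have hsm : StronglyMeasurable f := hf.stronglyMeasurable
  rw [h, integral_smul_measure, integral_finsetSum_measure]
  · simp [integral_dirac' _ _ hsm]
  · intro v _
    exact integrable_dirac' hsm (by simp)

/-- Convergence in probability of the empirical averages of a continuous function. -/
lemma emp_conv_aux {G 𝒳 : Type*} [Group G] [Countable G]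
    [MetricSpace 𝒳] [CompactSpace 𝒳] [SecondCountableTopology 𝒳]
    [MeasurableSpace 𝒳] [BorelSpace 𝒳]
    (V : ℕ → Type*) [∀ n, Fintype (V n)] [∀ n, Nonempty (V n)]
    (σ : ∀ n, G → Equiv.Perm (V n))
    (hσ1 : ∀ g h : G,
      Tendsto (fun n => (Nat.card {v : V n // σ n g (σ n h v) = σ n (g * h) v} : ℝ)
          / (Nat.card (V n))) atTop (𝓝 1))
    (μ : ProbabilityMeasure (G → 𝒳))
    (hinv : ∀ g : G,
      Measure.map (shiftMap G 𝒳 g) (μ : Measure (G → 𝒳)) = (μ : Measure (G → 𝒳)))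
    (herg : ∀ A : Set (G → 𝒳), MeasurableSet A → (∀ g : G, shiftMap G 𝒳 g ⁻¹' A = A) →
      (μ : Measure (G → 𝒳)) A = 0 ∨ (μ : Measure (G → 𝒳)) A = 1)
    (μn : ∀ n, ProbabilityMeasure (V n → 𝒳))
    (hlw : ∀ O ∈ 𝓝 μ,
      Tendsto (fun n => (Nat.card {v : V n // pushName (σ n) v (μn n) ∈ O} : ℝ)
          / (Nat.card (V n))) atTop (𝓝 1))
    (f : (G → 𝒳) → ℝ) (hf : Continuous f) (M : ℝ) (hM : ∀ y, |f y| ≤ M)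
    (ε : ℝ) (hε : 0 < ε) :
    Tendsto (fun n => (μn n : Measure (V n → 𝒳)).real
      {x | ε ≤ |∫ y, f y ∂(empProb (σ n) x : Measure (G → 𝒳)) -
        ∫ y, f y ∂(μ : Measure (G → 𝒳))|}) atTop (𝓝 0) := by
  rw [Metric.tendsto_atTop']
  suffices H : ∀ η : ℝ, 0 < η → ∀ᶠ n in atTop, (μn n : Measure (V n → 𝒳)).real
      {x | ε ≤ |∫ y, f y ∂(empProb (σ n) x : Measure (G → 𝒳)) -
        ∫ y, f y ∂(μ : Measure (G → 𝒳))|} < η by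
    intro η hη
    obtain ⟨N, hN⟩ := eventually_atTop.1 (H η hη)
    refine ⟨N, fun n hn => ?_⟩
    rw [Real.dist_eq, sub_zero, abs_of_nonneg measureReal_nonneg]
    exact hN n hn.le
  intro η hη
  set c := ∫ y, f y ∂(μ : Measure (G → 𝒳)) with hc
  have hfL : MemLp f 2 (μ : Measure (G → 𝒳)) :=
    MemLp.of_bound hf.aestronglyMeasurable M (Eventually.of_forall hM)
  have hηε : 0 < η * (ε / 2) := by positivity
  obtain ⟨F, hF, hFlt⟩ := ergAux_mean (μ : Measure (G → 𝒳)) (shiftMap G 𝒳)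
    (fun g => ⟨(shiftMap_continuous_aux g).measurable, hinv g⟩)
    (fun y => by ext h; simp [shiftMap]) (fun g h y => by ext k; simp [shiftMap, mul_assoc])
    herg f hfL (η * (ε / 2)) hηε
  obtain ⟨hFc, hFM, hFs⟩ := sofic_hull_aux V σ hσ1 f hf M hM F hF
  have hloc := local_avg_aux V σ μ μn hlw (fun y => |F y - c|) (by fun_prop) (M + |c|)
    (fun y => abs_nonneg _)
    (fun y => (abs_sub _ _).trans (by linarith [hFM y])) _ hFlt
  filter_upwards [hloc, hFs (ε / 2) (by linarith)] with n hn hs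
  have hcd : (0 : ℝ) < Fintype.card (V n) := by exact_mod_cast Fintype.card_pos
  let D : (V n → 𝒳) → ℝ := fun x =>
    (Fintype.card (V n) : ℝ)⁻¹ * ∑ v, |F (pullbackName (σ n) v x) - c|
  have hpc : ∀ v, Continuous (fun x : V n → 𝒳 => pullbackName (σ n) v x) := by
    intro v
    unfold pullbackName
    fun_prop
  have hti : ∀ v, Integrable (fun x => |F (pullbackName (σ n) v x) - c|)
      (μn n : Measure (V n → 𝒳)) := by
    intro v
    have hcc : Continuous (fun x : V n → 𝒳 => |F (pullbackName (σ n) v x) - c|) :=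
      ((hFc.comp (hpc v)).sub continuous_const).abs
    refine Integrable.of_bound hcc.aestronglyMeasurable (M + |c|) (Eventually.of_forall fun x => ?_)
    rw [Real.norm_eq_abs, abs_abs]
    exact (abs_sub _ _).trans (by linarith [hFM (pullbackName (σ n) v x)])
  have hDi : Integrable D (μn n : Measure (V n → 𝒳)) :=
    (integrable_finsetSum _ fun v _ => hti v).const_mul _
  have hDe : ∫ x, D x ∂(μn n : Measure (V n → 𝒳)) < η * (ε / 2) := by
    have : ∫ x, D x ∂(μn n : Measure (V n → 𝒳)) = (Fintype.card (V n) : ℝ)⁻¹ *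
      ∑ v, ∫ x, |F (pullbackName (σ n) v x) - c| ∂(μn n : Measure (V n → 𝒳)) := by
      simp only [D]
      rw [integral_const_mul, integral_finsetSum _ fun v _ => hti v]
    rw [this]
    exact hn
  have hDn : ∀ x, 0 ≤ D x := fun x =>
    mul_nonneg (inv_pos.2 hcd).le (Finset.sum_nonneg fun _ _ => abs_nonneg _)
  have hmark := mul_meas_ge_le_integral_of_nonneg (Eventually.of_forall hDn) hDi (ε / 2)
  have hsub : {x : V n → 𝒳 | ε ≤ |∫ y, f y ∂(empProb (σ n) x : Measure (G → 𝒳)) - c|} ⊆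
      {x | ε / 2 ≤ D x} := by
    intro x hx
    simp only [Set.mem_setOf_eq] at hx ⊢
    rw [integral_empProb_aux _ _ _ hf] at hx
    have h1 := hs x
    have h2 : |(Fintype.card (V n) : ℝ)⁻¹ * ∑ v, F (pullbackName (σ n) v x) - c| ≤ D x := by
      have : (Fintype.card (V n) : ℝ)⁻¹ * ∑ v, F (pullbackName (σ n) v x) - c =
          (Fintype.card (V n) : ℝ)⁻¹ * ∑ v, (F (pullbackName (σ n) v x) - c) := by
        rw [Finset.sum_sub_distrib, mul_sub]
        simp only [Finset.sum_const, Finset.card_univ, nsmul_eq_mul]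
        rw [inv_mul_cancel_left₀ hcd.ne']
      rw [this, abs_mul, abs_of_pos (inv_pos.2 hcd)]
      exact mul_le_mul_of_nonneg_left (Finset.abs_sum_le_sum_abs _ _) (inv_pos.2 hcd).le
    rw [abs_sub_comm] at h1
    have h3 := abs_sub_le ((Fintype.card (V n) : ℝ)⁻¹ * ∑ v, f (pullbackName (σ n) v x))
      ((Fintype.card (V n) : ℝ)⁻¹ * ∑ v, F (pullbackName (σ n) v x)) c
    linarith
  have hmono := measureReal_mono (μ := (μn n : Measure (V n → 𝒳))) hsub
  have : (ε / 2) * (μn n : Measure (V n → 𝒳)).real {x | ε / 2 ≤ D x} < (ε / 2) * η := by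
    linarith
  exact hmono.trans_lt (lt_of_mul_lt_mul_left this (by linarith))

/-- **For ergodic processes, local weak* convergence implies quenched convergence.**
If `μ` is an ergodic shift-invariant probability measure on `𝒳^G` and
`μ_n` locally weak* converges to `μ` over the sofic approximation, then
`μ_n(Ω(O,σ_n)) → 1` for every weak* neighbourhood `O` of `μ`, where
`Ω(O,σ_n) = {x : P^{σ_n}_x ∈ O}`. -/
theorem lw_to_quenched_of_ergodic {G 𝒳 : Type*} [Group G] [Countable G]
    [MetricSpace 𝒳] [CompactSpace 𝒳] [SecondCountableTopology 𝒳]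
    [MeasurableSpace 𝒳] [BorelSpace 𝒳]
    (V : ℕ → Type*) [∀ n, Fintype (V n)] [∀ n, Nonempty (V n)]
    (σ : ∀ n, G → Equiv.Perm (V n))
    (hσ1 : ∀ g h : G,
      Tendsto (fun n => (Nat.card {v : V n // σ n g (σ n h v) = σ n (g * h) v} : ℝ)
          / (Nat.card (V n))) atTop (𝓝 1))
    (hσ2 : ∀ g : G, g ≠ 1 →
      Tendsto (fun n => (Nat.card {v : V n // σ n g v ≠ v} : ℝ)
          / (Nat.card (V n))) atTop (𝓝 1))
    (μ : ProbabilityMeasure (G → 𝒳))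
    (hinv : ∀ g : G,
      Measure.map (shiftMap G 𝒳 g) (μ : Measure (G → 𝒳)) = (μ : Measure (G → 𝒳)))
    (herg : ∀ A : Set (G → 𝒳), MeasurableSet A → (∀ g : G, shiftMap G 𝒳 g ⁻¹' A = A) →
      (μ : Measure (G → 𝒳)) A = 0 ∨ (μ : Measure (G → 𝒳)) A = 1)
    (μn : ∀ n, ProbabilityMeasure (V n → 𝒳))
    (hlw : ∀ O ∈ 𝓝 μ,
      Tendsto (fun n => (Nat.card {v : V n // pushName (σ n) v (μn n) ∈ O} : ℝ)
          / (Nat.card (V n))) atTop (𝓝 1)) :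
    ∀ O ∈ 𝓝 μ,
      Tendsto (fun n => ((μn n) {x : V n → 𝒳 | empProb (σ n) x ∈ O} : ℝ≥0))
        atTop (𝓝 1) := by
    -- the filter of sets whose complement has asymptotically vanishing probability
  let Z : Filter (ProbabilityMeasure (G → 𝒳)) :=
    { sets := {O | Tendsto (fun n => (μn n : Measure (V n → 𝒳)).real
        {x | empProb (σ n) x ∉ O}) atTop (𝓝 0)}
      univ_sets := by simp
      sets_of_superset := by
        intro A B hA hAB
        refine squeeze_zero (fun n => measureReal_nonneg) (fun n => ?_) hA
        exact measureReal_mono fun x hx hxA => hx (hAB hxA)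
      inter_sets := by
        intro A B hA hB
        have hAB := Tendsto.add hA hB
        rw [add_zero] at hAB
        refine squeeze_zero (fun n => measureReal_nonneg) (fun n => ?_) hAB
        refine le_trans (measureReal_mono ?_) (measureReal_union_le _ _)
        intro x hx
        simp only [Set.mem_setOf_eq, Set.mem_inter_iff, Set.mem_union] at hx ⊢
        tauto }
  have hZ : Tendsto (fun ν : ProbabilityMeasure (G → 𝒳) => ν) Z (𝓝 μ) := by
    rw [ProbabilityMeasure.tendsto_iff_forall_integral_tendsto]
    intro f
    rw [Metric.tendsto_nhds]
    intro ε hε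
    have h := emp_conv_aux V σ hσ1 μ hinv herg μn hlw f f.continuous ‖f‖
      (fun y => f.norm_coe_le_norm y) ε hε
    change Tendsto (fun n => (μn n : Measure (V n → 𝒳)).real _) atTop (𝓝 0)
    simpa only [Set.mem_setOf_eq, not_lt, Real.dist_eq] using h
  intro O hO
  have hOZ : Tendsto (fun n => (μn n : Measure (V n → 𝒳)).real
        {x | empProb (σ n) x ∉ O}) atTop (𝓝 0) := hZ hO
  rw [← NNReal.tendsto_coe]
  have h1 := hOZ.const_sub 1
  rw [sub_zero] at h1
  refine tendsto_of_tendsto_of_tendsto_of_le_of_le h1 tendsto_const_nhds (fun n => ?_)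
    (fun n => ?_)
  · have h2 := measureReal_union_le (μ := (μn n : Measure (V n → 𝒳)))
      {x | empProb (σ n) x ∈ O} {x | empProb (σ n) x ∉ O}
    have h3 : {x : V n → 𝒳 | empProb (σ n) x ∈ O} ∪ {x | empProb (σ n) x ∉ O} = Set.univ := by
      ext x
      simp [em]
    rw [h3, probReal_univ] at h2
    change 1 - _ ≤ (μn n : Measure (V n → 𝒳)).real {x | empProb (σ n) x ∈ O}
    linarith
  · exact (measureReal_le_one (μ := (μn n : Measure (V n → 𝒳))))
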